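/- arXiv:math/0405232 — 5 statements merged into one kernel-verified Lean document; each statement's English description precedes it below -/
import Mathlib

section
/- Let q ≥ 1 be an integer with q ≡ 1 (mod N) and let x₁, …, x_q ∈ ℂ be pairwise incongruent modulo the lattice L(τ) (i.e. x_i − x_j ∉ L(τ) for i ≠ j) with x_i ∉ L(τ) for every i. Then ∑_{i=1}^{q} (1/f(x_i)) · ∏_{j ≠ i} 1/f(x_j − x_i) = ∏_{i=1}^{q} 1/f(x_i). -/
open Complex

/-- `Φ(τ,x) = (1 − e^{−x}) ∏_{n≥1} (1 − qⁿe^{−x})(1 − qⁿeˣ)/(1 − qⁿ)²` with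
`q = exp(2πiτ)`. -/
noncomputable def Phi (τ x : ℂ) : ℂ :=
  (1 - Complex.exp (-x)) *
    ∏' n : ℕ,
      ((1 - Complex.exp (2 * Real.pi * Complex.I * τ) ^ (n + 1) * Complex.exp (-x)) *
        (1 - Complex.exp (2 * Real.pi * Complex.I * τ) ^ (n + 1) * Complex.exp x) /
        (1 - Complex.exp (2 * Real.pi * Complex.I * τ) ^ (n + 1)) ^ 2)

/-- The lattice `L(τ) = {2πi(mτ + n) : m, n ∈ ℤ}`. -/
def lat (τ : ℂ) : Set ℂ :=
  {z | ∃ m n : ℤ, z = 2 * Real.pi * Complex.I * (m * τ + n)}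

/-- The normalized elliptic function `f` of level `N`:
`f(x) = Φ(τ,x)·Φ(τ,−α)/Φ(τ,x−α)` with `α = 2πi/N` (division by `0` yields `0`). -/
noncomputable def ellf (τ : ℂ) (N : ℕ) (x : ℂ) : ℂ :=
  Phi τ x * Phi τ (-(2 * Real.pi * Complex.I / N)) /
    Phi τ (x - 2 * Real.pi * Complex.I / N)

/-- The extended reciprocal `1/f(x) = Φ(τ,x−α)/(Φ(τ,x)·Φ(τ,−α))`, with the
convention that a quotient with vanishing denominator is `0`. -/
noncomputable def invEllf (τ : ℂ) (N : ℕ) (x : ℂ) : ℂ :=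
  Phi τ (x - 2 * Real.pi * Complex.I / N) /
    (Phi τ x * Phi τ (-(2 * Real.pi * Complex.I / N)))

/-- The nome `q = exp(2πiτ)`. -/
noncomputable def nome (τ : ℂ) : ℂ := Complex.exp (2 * Real.pi * Complex.I * τ)

/-- The `n`-th factor of the infinite product defining `Phi`. -/
noncomputable def phiFactor (τ : ℂ) (n : ℕ) (x : ℂ) : ℂ :=
  (1 - nome τ ^ (n + 1) * exp (-x)) * (1 - nome τ ^ (n + 1) * exp x) / (1 - nome τ ^ (n + 1)) ^ 2

lemma Phi_eq (τ x : ℂ) : Phi τ x = (1 - exp (-x)) * ∏' n, phiFactor τ n x := rfl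

lemma nome_ne_zero (τ : ℂ) : nome τ ≠ 0 := exp_ne_zero _

lemma norm_nome_lt_one {τ : ℂ} (hτ : 0 < τ.im) : ‖nome τ‖ < 1 := by
  rw [nome, norm_exp, Real.exp_lt_one_iff]
  have : (2 * Real.pi * I * τ).re = -(2 * Real.pi * τ.im) := by simp
  rw [this]
  have := Real.pi_pos
  simp only [Left.neg_neg_iff]
  positivity

lemma one_sub_nome_pow_ne_zero {τ : ℂ} (hτ : 0 < τ.im) (n : ℕ) : 1 - nome τ ^ (n + 1) ≠ 0 := by
  intro h
  have h1 : ‖nome τ ^ (n + 1)‖ = 1 := by rw [← sub_eq_zero.mp h]; simp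
  rw [norm_pow] at h1
  exact (pow_lt_one₀ (norm_nonneg _) (norm_nome_lt_one hτ) n.succ_ne_zero).ne h1

lemma phiFactor_sub_one {τ : ℂ} (hτ : 0 < τ.im) (n : ℕ) (x : ℂ) :
    phiFactor τ n x - 1 =
      nome τ ^ (n + 1) * (2 - exp x - exp (-x)) / (1 - nome τ ^ (n + 1)) ^ 2 := by
  have h := one_sub_nome_pow_ne_zero hτ n
  have he : exp (-x) * exp x = 1 := by rw [← exp_add]; simp
  rw [phiFactor]
  field_simp
  linear_combination (nome τ ^ (n + 1)) ^ 2 * he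

lemma differentiable_phiFactor (τ : ℂ) (n : ℕ) : Differentiable ℂ (phiFactor τ n) := by
  unfold phiFactor
  fun_prop

lemma norm_phiFactor_sub_one_le {τ : ℂ} (hτ : 0 < τ.im) {R : ℝ} (n : ℕ) {x : ℂ} (hx : ‖x‖ ≤ R) :
    ‖phiFactor τ n x - 1‖ ≤ ‖nome τ‖ ^ n * ((2 + 2 * Real.exp R) / (1 - ‖nome τ‖) ^ 2) := by
  have hq := norm_nome_lt_one hτ
  have hexp : ∀ y : ℂ, ‖y‖ ≤ R → ‖exp y‖ ≤ Real.exp R := fun y hy ↦ by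
    rw [norm_exp]
    exact Real.exp_le_exp.mpr ((re_le_norm y).trans hy)
  have h1 : ‖2 - exp x - exp (-x)‖ ≤ 2 + 2 * Real.exp R := by
    have a := hexp x hx
    have b := hexp (-x) (by simpa using hx)
    have c := norm_sub_le (2 - exp x) (exp (-x))
    have d := norm_sub_le 2 (exp x)
    have e : ‖(2 : ℂ)‖ = 2 := by simp
    linarith
  have h2 : 1 - ‖nome τ‖ ≤ ‖1 - nome τ ^ (n + 1)‖ := by
    have a := norm_sub_norm_le 1 (nome τ ^ (n + 1))
    have b : ‖nome τ ^ (n + 1)‖ ≤ ‖nome τ‖ := by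
      rw [norm_pow]
      exact pow_le_of_le_one (norm_nonneg _) hq.le n.succ_ne_zero
    have e : ‖(1 : ℂ)‖ = 1 := by simp
    linarith
  have h3 : ‖nome τ‖ ^ (n + 1) ≤ ‖nome τ‖ ^ n := pow_le_pow_of_le_one (norm_nonneg _) hq.le n.le_succ
  have h4 : 0 < 1 - ‖nome τ‖ := sub_pos.mpr hq
  rw [phiFactor_sub_one hτ, norm_div, norm_mul, norm_pow, norm_pow, mul_div_assoc]
  gcongr

lemma summable_nome_pow_mul {τ : ℂ} (hτ : 0 < τ.im) (C : ℝ) :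
    Summable fun n : ℕ ↦ ‖nome τ‖ ^ n * C :=
  (summable_geometric_of_lt_one (norm_nonneg _) (norm_nome_lt_one hτ)).mul_right C

lemma summable_norm_phiFactor_sub_one {τ : ℂ} (hτ : 0 < τ.im) (x : ℂ) :
    Summable fun n ↦ ‖phiFactor τ n x - 1‖ :=
  .of_nonneg_of_le (fun _ ↦ norm_nonneg _) (fun n ↦ norm_phiFactor_sub_one_le hτ n le_rfl)
    (summable_nome_pow_mul hτ _)

lemma multipliable_phiFactor {τ : ℂ} (hτ : 0 < τ.im) (x : ℂ) :
    Multipliable fun n ↦ phiFactor τ n x := by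
  simpa using multipliable_one_add_of_summable (summable_norm_phiFactor_sub_one hτ x)

lemma differentiable_tprod_phiFactor {τ : ℂ} (hτ : 0 < τ.im) :
    Differentiable ℂ fun x ↦ ∏' n, phiFactor τ n x := by
  intro x
  have hK : IsOpen (Metric.ball (0 : ℂ) (‖x‖ + 1)) := Metric.isOpen_ball
  have hd := (Summable.hasProdLocallyUniformlyOn_nat_one_add (f := fun n y ↦ phiFactor τ n y - 1) hK
    (summable_nome_pow_mul hτ ((2 + 2 * Real.exp (‖x‖ + 1)) / (1 - ‖nome τ‖) ^ 2))
    (.of_forall fun n y hy ↦ norm_phiFactor_sub_one_le hτ n (mem_ball_zero_iff.mp hy).le)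
    fun n ↦ ((differentiable_phiFactor τ n).continuous.sub continuous_const).continuousOn)
  simp only [add_sub_cancel] at hd
  refine (hd.differentiableOn (.of_forall fun s ↦ ?_) hK).differentiableAt
    (hK.mem_nhds (by simp))
  exact DifferentiableOn.fun_finsetProd fun n _ ↦ (differentiable_phiFactor τ n).differentiableOn

lemma differentiable_Phi {τ : ℂ} (hτ : 0 < τ.im) : Differentiable ℂ (Phi τ) := by
  have := differentiable_tprod_phiFactor hτ
  unfold Phi
  change Differentiable ℂ fun x ↦ (1 - exp (-x)) * ∏' n, phiFactor τ n x
  fun_prop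

lemma tprod_phiFactor_ne_zero {τ : ℂ} (hτ : 0 < τ.im) {x : ℂ} (h : ∀ n, phiFactor τ n x ≠ 0) :
    ∏' n, phiFactor τ n x ≠ 0 := by
  simpa using tprod_one_add_ne_zero_of_summable (f := fun n ↦ phiFactor τ n x - 1)
    (by simpa using h) (summable_norm_phiFactor_sub_one hτ x)

lemma mem_lat_of_nome_pow_mul_exp {τ x : ℂ} {n : ℕ} (h : nome τ ^ n * exp x = 1) : x ∈ lat τ := by
  rw [nome, ← exp_nat_mul, ← exp_add, exp_eq_one_iff] at h
  obtain ⟨k, hk⟩ := h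
  refine ⟨-n, k, ?_⟩
  push_cast
  linear_combination hk

lemma neg_mem_lat {τ x : ℂ} (h : x ∈ lat τ) : -x ∈ lat τ := by
  obtain ⟨m, n, rfl⟩ := h
  exact ⟨-m, -n, by push_cast; ring⟩

lemma neg_mem_lat_iff {τ x : ℂ} : -x ∈ lat τ ↔ x ∈ lat τ :=
  ⟨fun h ↦ by simpa using neg_mem_lat h, neg_mem_lat⟩

lemma Phi_ne_zero {τ : ℂ} (hτ : 0 < τ.im) {x : ℂ} (hx : x ∉ lat τ) : Phi τ x ≠ 0 := by
  have h1 : ∀ n : ℕ, 1 - nome τ ^ n * exp (-x) ≠ 0 := fun n h ↦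
    hx (neg_mem_lat_iff.mp (mem_lat_of_nome_pow_mul_exp (sub_eq_zero.mp h).symm))
  have h2 : ∀ n : ℕ, 1 - nome τ ^ n * exp x ≠ 0 := fun n h ↦
    hx (mem_lat_of_nome_pow_mul_exp (sub_eq_zero.mp h).symm)
  rw [Phi_eq]
  refine mul_ne_zero (by simpa using h1 0) (tprod_phiFactor_ne_zero hτ fun n ↦ ?_)
  exact div_ne_zero (mul_ne_zero (h1 _) (h2 _)) (pow_ne_zero _ (one_sub_nome_pow_ne_zero hτ n))

lemma Phi_zero (τ : ℂ) : Phi τ 0 = 0 := by simp [Phi]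

lemma deriv_Phi_zero {τ : ℂ} (hτ : 0 < τ.im) : deriv (Phi τ) 0 ≠ 0 := by
  have hd := (differentiable_tprod_phiFactor hτ 0).hasDerivAt
  have he : HasDerivAt (fun x : ℂ ↦ 1 - exp (-x)) 1 0 := by
    simpa using ((hasDerivAt_neg (0 : ℂ)).cexp).const_sub 1
  have h := he.fun_mul hd
  have hP : Phi τ = fun x ↦ (1 - exp (-x)) * ∏' n, phiFactor τ n x := funext (Phi_eq τ)
  rw [hP, h.deriv]
  simp only [neg_zero, exp_zero, sub_self, zero_mul, add_zero, one_mul]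
  refine tprod_phiFactor_ne_zero hτ fun n ↦ ?_
  have := one_sub_nome_pow_ne_zero hτ n
  simp [phiFactor, this]

lemma Phi_add_two_pi_I (τ x : ℂ) : Phi τ (x + 2 * Real.pi * I) = Phi τ x := by
  have h1 : exp (x + 2 * Real.pi * I) = exp x := exp_periodic x
  have h2 : exp (-(x + 2 * Real.pi * I)) = exp (-x) := by rw [exp_neg, h1, exp_neg]
  simp only [Phi, h1, h2]

/-- The quasi-period factor of `Phi` under translation by `2πiτ`. -/
noncomputable def phiMul (τ x : ℂ) : ℂ := -(exp (-x) / nome τ)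

lemma phiMul_ne_zero (τ x : ℂ) : phiMul τ x ≠ 0 :=
  neg_ne_zero.mpr (div_ne_zero (exp_ne_zero _) (nome_ne_zero τ))

lemma differentiable_phiMul (τ : ℂ) : Differentiable ℂ (phiMul τ) := by
  unfold phiMul
  fun_prop

lemma phiMul_sub (τ x a : ℂ) : phiMul τ (x - a) = exp a * phiMul τ x := by
  rw [phiMul, phiMul, neg_sub, sub_eq_add_neg, exp_add]
  ring

lemma Phi_neg (τ x : ℂ) : Phi τ (-x) = -(exp x * Phi τ x) := by
  have he : exp (-x) * exp x = 1 := by rw [← exp_add]; simp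
  have h : ∀ n, phiFactor τ n (-x) = phiFactor τ n x := fun n ↦ by
    simp only [phiFactor, neg_neg]; ring
  simp only [Phi_eq, h, neg_neg]
  linear_combination (- ∏' n, phiFactor τ n x) * he

lemma exp_neg_add_period (τ x : ℂ) :
    exp (-(x + 2 * Real.pi * I * τ)) = exp (-x) / nome τ := by
  rw [nome, ← exp_sub]
  ring_nf

lemma exp_add_period (τ x : ℂ) : exp (x + 2 * Real.pi * I * τ) = exp x * nome τ := exp_add _ _

lemma partialProd_add_period (τ x : ℂ) (n : ℕ) :
    (1 - exp (-(x + 2 * Real.pi * I * τ))) *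
        (∏ k ∈ Finset.range n, phiFactor τ k (x + 2 * Real.pi * I * τ)) *
        (1 - nome τ ^ n * exp (-x)) =
      phiMul τ x * ((1 - exp (-x)) * (∏ k ∈ Finset.range n, phiFactor τ k x) *
        (1 - nome τ ^ (n + 1) * exp x)) := by
  have hq := nome_ne_zero τ
  have he : exp (-x) * exp x = 1 := by rw [← exp_add]; simp
  induction n with
  | zero =>
    simp only [exp_neg_add_period, phiMul, Finset.range_zero, Finset.prod_empty]
    field_simp
    linear_combination (nome τ * (exp (-x) - 1)) * he
  | succ n ih =>
    rw [Finset.prod_range_succ, Finset.prod_range_succ]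
    have h1 : phiFactor τ n (x + 2 * Real.pi * I * τ) =
        (1 - nome τ ^ n * exp (-x)) * (1 - nome τ ^ (n + 2) * exp x) /
          (1 - nome τ ^ (n + 1)) ^ 2 := by
      rw [phiFactor, exp_neg_add_period, exp_add_period]
      congr 2
      · field_simp
        ring
      · ring
    rw [h1, phiFactor]
    linear_combination ((1 - nome τ ^ (n + 2) * exp x) / (1 - nome τ ^ (n + 1)) ^ 2 *
      (1 - nome τ ^ (n + 1) * exp (-x))) * ih

lemma Phi_add_period {τ : ℂ} (hτ : 0 < τ.im) (x : ℂ) :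
    Phi τ (x + 2 * Real.pi * I * τ) = phiMul τ x * Phi τ x := by
  have hpow : Filter.Tendsto (fun n : ℕ ↦ nome τ ^ n) Filter.atTop (nhds 0) :=
    tendsto_pow_atTop_nhds_zero_of_norm_lt_one (norm_nome_lt_one hτ)
  have hlim : ∀ y, Filter.Tendsto (fun n ↦ ∏ k ∈ Finset.range n, phiFactor τ k y) Filter.atTop
      (nhds (∏' n, phiFactor τ n y)) := fun y ↦
    (multipliable_phiFactor hτ y).hasProd.tendsto_prod_nat
  have hL := ((hlim (x + 2 * Real.pi * I * τ)).const_mul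
    (1 - exp (-(x + 2 * Real.pi * I * τ)))).mul ((hpow.mul_const (exp (-x))).const_sub 1)
  have hR := (((hlim x).const_mul (1 - exp (-x))).mul
    ((((Filter.tendsto_add_atTop_iff_nat 1).mpr hpow).mul_const (exp x)).const_sub 1)).const_mul
      (phiMul τ x)
  simp only [partialProd_add_period] at hL
  simpa [Phi_eq] using tendsto_nhds_unique hL hR

lemma iff_add_of_mem_lat {τ : ℂ} {P : ℂ → Prop} (h₁ : ∀ z, P (z + 2 * Real.pi * I) ↔ P z)
    (h₂ : ∀ z, P (z + 2 * Real.pi * I * τ) ↔ P z) (a : ℂ) {z : ℂ} (hz : z ∈ lat τ) :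
    P (a + z) ↔ P a := by
  have key : ∀ w : ℂ, (∀ y, P (y + w) ↔ P y) → ∀ (n : ℤ) (y : ℂ), P (y + n * w) ↔ P y := by
    intro w hw n
    induction n with
    | zero => simp
    | succ n ih =>
      intro y
      have h : y + ((n + 1 : ℤ) : ℂ) * w = y + (n : ℤ) * w + w := by push_cast; ring
      rw [h, hw, ih]
    | pred n ih =>
      intro y
      have h : y + ((-n - 1 : ℤ) : ℂ) * w + w = y + (-n : ℤ) * w := by push_cast; ring
      rw [← hw, h, ih]
  obtain ⟨m, n, rfl⟩ := hz
  have h : a + 2 * Real.pi * I * (m * τ + n) =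
      a + m * (2 * Real.pi * I * τ) + n * (2 * Real.pi * I) := by ring
  rw [h, key _ h₁, key _ h₂]

lemma Phi_eq_zero_and_deriv_ne_zero {τ : ℂ} (hτ : 0 < τ.im) {z : ℂ} (hz : z ∈ lat τ) :
    Phi τ z = 0 ∧ deriv (Phi τ) z ≠ 0 := by
  have h := iff_add_of_mem_lat (P := fun z ↦ Phi τ z = 0 ∧ deriv (Phi τ) z ≠ 0)
    (fun z ↦ ?_) (fun z ↦ ?_) 0 hz
  · rw [zero_add] at h
    exact h.mpr ⟨Phi_zero τ, deriv_Phi_zero hτ⟩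
  · rw [← deriv_comp_add_const (Phi τ) (2 * Real.pi * I) z]
    simp only [Phi_add_two_pi_I]
  · have hd : deriv (Phi τ) (z + 2 * Real.pi * I * τ) =
        deriv (phiMul τ) z * Phi τ z + phiMul τ z * deriv (Phi τ) z := by
      rw [← deriv_comp_add_const (Phi τ) (2 * Real.pi * I * τ) z]
      simp only [Phi_add_period hτ]
      exact deriv_fun_mul (differentiable_phiMul τ z) (differentiable_Phi hτ z)
    rw [hd, Phi_add_period hτ]
    have hm := phiMul_ne_zero τ z
    simp only [mul_eq_zero, hm, false_or]
    refine and_congr_right fun h0 ↦ ?_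
    simp [h0, hm]

lemma Phi_eq_zero_iff {τ : ℂ} (hτ : 0 < τ.im) {z : ℂ} : Phi τ z = 0 ↔ z ∈ lat τ :=
  ⟨fun h ↦ by_contra fun hz ↦ Phi_ne_zero hτ hz h, fun h ↦ (Phi_eq_zero_and_deriv_ne_zero hτ h).1⟩

/-- An entire function vanishing at all zeros of an entire function with simple zeros is
divisible by it. -/
lemma exists_differentiable_eq_mul {H T : ℂ → ℂ} (hH : Differentiable ℂ H) (hT : Differentiable ℂ T)
    (h : ∀ c, T c = 0 → H c = 0 ∧ deriv T c ≠ 0) :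
    ∃ K : ℂ → ℂ, Differentiable ℂ K ∧ ∀ t, H t = T t * K t := by
  classical
  have hds : ∀ {f : ℂ → ℂ} (c : ℂ), Differentiable ℂ f → Differentiable ℂ (dslope f c) := by
    intro f c hf
    rw [← differentiableOn_univ] at hf ⊢
    exact (Complex.differentiableOn_dslope Filter.univ_mem).mpr hf
  refine ⟨fun t ↦ if T t = 0 then deriv H t / deriv T t else H t / T t, fun c ↦ ?_, fun t ↦ ?_⟩
  · by_cases hc : T c = 0
    · obtain ⟨hHc, hTc⟩ := h c hc
      have hslope : dslope T c c ≠ 0 := by rwa [dslope_same]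
      refine ((hds c hH c).div (hds c hT c) hslope).congr_of_eventuallyEq ?_
      filter_upwards [(hds c hT).continuous.continuousAt.eventually_ne hslope] with t ht
      by_cases htc : t = c
      · subst htc
        simp [hc]
      · have htc' : t - c ≠ 0 := sub_ne_zero.mpr htc
        have hT' : dslope T c t = T t / (t - c) := by
          rw [dslope_of_ne _ htc, slope_def_field, hc, sub_zero]
        have hH' : dslope H c t = H t / (t - c) := by
          rw [dslope_of_ne _ htc, slope_def_field, hHc, sub_zero]
        have hTt : T t ≠ 0 := fun h0 ↦ ht (by rw [hT', h0, zero_div])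
        simp only [hTt, if_false, Pi.div_apply, hT', hH']
        field_simp
    · refine ((hH c).div (hT c) hc).congr_of_eventuallyEq ?_
      filter_upwards [hT.continuous.continuousAt.eventually_ne hc] with t ht
      simp [ht]
  · by_cases ht : T t = 0
    · simp [ht, (h t ht).1]
    · simp [ht, mul_div_cancel₀]

lemma Differentiable.eq_zero_of_mul_eq_zero {T K : ℂ → ℂ} (hT : Differentiable ℂ T)
    (hK : Differentiable ℂ K) {c : ℂ} (hc : T c ≠ 0) (h : ∀ t, T t * K t = 0) (t : ℂ) : K t = 0 := by
  have hev : K =ᶠ[nhds c] 0 := by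
    filter_upwards [hT.continuous.continuousAt.eventually_ne hc] with t ht
    exact (mul_eq_zero.mp (h t)).resolve_left ht
  exact congr_fun (AnalyticOnNhd.eq_of_eventuallyEq
    (fun z _ ↦ hK.analyticAt z) (fun z _ ↦ analyticAt_const) hev) t

lemma div_natCast_notMem_lat {τ : ℂ} (hτ : 0 < τ.im) {N : ℕ} (hN : 2 ≤ N) :
    2 * Real.pi * I / N ∉ lat τ := by
  rintro ⟨m, n, h⟩
  have hN0 : (N : ℂ) ≠ 0 := Nat.cast_ne_zero.mpr (by omega)
  have h' : (1 : ℂ) = N * (m * τ + n) := by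
    have h2 := two_pi_I_ne_zero
    field_simp at h
    linear_combination h
  have hm : m = 0 := by
    have := congr_arg Complex.im h'
    simp at this
    rcases this with h | h | h
    · omega
    · exact h
    · exact absurd h hτ.ne'
  have h3 : (1 : ℤ) = N * n := by
    rw [hm] at h'
    simp only [Int.cast_zero, zero_mul, zero_add] at h'
    exact_mod_cast h'
  have := Int.eq_one_or_neg_one_of_mul_eq_one h3.symm
  omega

/-- Division of a theta-like function by a translate of `Phi`. -/
lemma exists_eq_Phi_mul {τ : ℂ} (hτ : 0 < τ.im) {H u : ℂ → ℂ} {a : ℂ} (hH : Differentiable ℂ H)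
    (hu : Differentiable ℂ u) (hu0 : ∀ t, u t ≠ 0)
    (h₁ : ∀ t, H (t + 2 * Real.pi * I) = H t)
    (h₂ : ∀ t, H (t + 2 * Real.pi * I * τ) = u t * phiMul τ (t - a) * H t) (ha : H a = 0) :
    ∃ K : ℂ → ℂ, Differentiable ℂ K ∧ (∀ t, K (t + 2 * Real.pi * I) = K t) ∧
      (∀ t, K (t + 2 * Real.pi * I * τ) = u t * K t) ∧ ∀ t, H t = Phi τ (t - a) * K t := by
  have hPhi := differentiable_Phi hτ
  have hT : Differentiable ℂ fun t ↦ Phi τ (t - a) := by fun_prop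
  obtain ⟨K, hK, hHK⟩ := exists_differentiable_eq_mul hH hT fun c hc ↦ by
    have hc' := (Phi_eq_zero_iff hτ).mp hc
    constructor
    · have := iff_add_of_mem_lat (P := fun z ↦ H z = 0) (fun z ↦ by rw [h₁]) (fun z ↦ by
        rw [h₂]; simp [hu0, phiMul_ne_zero]) a hc'
      rw [add_sub_cancel] at this
      exact this.mpr ha
    · rw [deriv_comp_sub_const]
      exact (Phi_eq_zero_and_deriv_ne_zero hτ hc').2
  have hne : Phi τ (a + 2 * Real.pi * I / (2 : ℕ) - a) ≠ 0 := by
    rw [add_sub_cancel_left]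
    exact Phi_ne_zero hτ (div_natCast_notMem_lat hτ le_rfl)
  refine ⟨K, hK, fun t ↦ sub_eq_zero.mp ?_, fun t ↦ sub_eq_zero.mp ?_, hHK⟩
  · refine hT.eq_zero_of_mul_eq_zero (K := fun t ↦ K (t + 2 * Real.pi * I) - K t) (by fun_prop) hne
      (fun t ↦ ?_) t
    have h := h₁ t
    rw [hHK, hHK, add_sub_right_comm, Phi_add_two_pi_I] at h
    linear_combination h
  · refine hT.eq_zero_of_mul_eq_zero (K := fun t ↦ K (t + 2 * Real.pi * I * τ) - u t * K t)
      (by fun_prop) hne (fun t ↦ ?_) t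
    have h := h₂ t
    rw [hHK, hHK, add_sub_right_comm, Phi_add_period hτ] at h
    apply mul_left_cancel₀ (phiMul_ne_zero τ (t - a))
    linear_combination h

/-- An entire function which is `2πi`-periodic and gets multiplied by a nontrivial unitary
constant under translation by `2πiτ` vanishes. -/
lemma eq_zero_of_quasiperiodic {τ : ℂ} (hτ : 0 < τ.im) {K : ℂ → ℂ} (hK : Differentiable ℂ K) {ζ : ℂ}
    (hζ : ‖ζ‖ = 1) (hζ1 : ζ ≠ 1) (h₁ : ∀ t, K (t + 2 * Real.pi * I) = K t)
    (h₂ : ∀ t, K (t + 2 * Real.pi * I * τ) = ζ * K t) (t : ℂ) : K t = 0 := by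
  let p : ℝ × ℝ → ℂ := fun v ↦ 2 * Real.pi * I * (v.1 * τ + v.2)
  have hp : Continuous p := by fun_prop
  have hcomp : IsCompact (p '' (Set.Icc 0 1 ×ˢ Set.Icc 0 1)) :=
    (isCompact_Icc.prod isCompact_Icc).image hp
  obtain ⟨C, hC⟩ := hcomp.exists_bound_of_continuousOn hK.continuous.continuousOn
  have hbd : ∀ z, ‖K z‖ ≤ C := by
    intro z
    set w := z / (2 * Real.pi * I) with hw
    set r := w.im / τ.im with hr
    set s := w.re - r * τ.re with hs
    have hz : z = 2 * Real.pi * I * (r * τ + s) := by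
      have : w = r * τ + s := by
        apply Complex.ext
        · simp [hs]
        · simp [hr, hτ.ne']
      rw [← this, hw, mul_div_cancel₀ _ two_pi_I_ne_zero]
    have hmem : 2 * Real.pi * I * (⌊r⌋ * τ + ⌊s⌋) ∈ lat τ := ⟨_, _, rfl⟩
    have h := iff_add_of_mem_lat (P := fun y ↦ ‖K y‖ ≤ C) (fun y ↦ by rw [h₁])
      (fun y ↦ by rw [h₂, norm_mul, hζ, one_mul]) (p (Int.fract r, Int.fract s)) hmem
    have hsum : p (Int.fract r, Int.fract s) + 2 * Real.pi * I * (⌊r⌋ * τ + ⌊s⌋) = z := by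
      rw [hz]
      simp only [p, Int.fract]
      push_cast
      ring
    rw [hsum] at h
    refine h.mpr (hC _ ⟨_, ⟨⟨Int.fract_nonneg _, (Int.fract_lt_one _).le⟩,
      ⟨Int.fract_nonneg _, (Int.fract_lt_one _).le⟩⟩, rfl⟩)
  have hb : Bornology.IsBounded (Set.range K) :=
    isBounded_iff_forall_norm_le.mpr ⟨C, by rintro _ ⟨z, rfl⟩; exact hbd z⟩
  have h := h₂ t
  rw [hK.apply_eq_apply_of_bounded hb (t + 2 * Real.pi * I * τ) t] at h
  have : (1 - ζ) * K t = 0 := by linear_combination h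
  exact (mul_eq_zero.mp this).resolve_left (sub_ne_zero.mpr hζ1.symm)

/-- A theta-like function with the zeros of `∏ k ∈ s, Phi τ (t - a k)` and a nontrivial
unitary twist of its quasi-period factor vanishes. -/
lemma eq_zero_of_prod_phiMul {τ : ℂ} (hτ : 0 < τ.im) {ζ : ℂ} (hζ : ‖ζ‖ = 1) (hζ1 : ζ ≠ 1)
    {ι : Type*} (s : Finset ι) (a : ι → ℂ)
    (ha : ∀ i ∈ s, ∀ j ∈ s, i ≠ j → a i - a j ∉ lat τ) (H : ℂ → ℂ) (hH : Differentiable ℂ H)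
    (h₁ : ∀ t, H (t + 2 * Real.pi * I) = H t)
    (h₂ : ∀ t, H (t + 2 * Real.pi * I * τ) = (ζ * ∏ k ∈ s, phiMul τ (t - a k)) * H t)
    (h0 : ∀ k ∈ s, H (a k) = 0) (t : ℂ) : H t = 0 := by
  classical
  induction s using Finset.induction_on generalizing H with
  | empty => exact eq_zero_of_quasiperiodic hτ hH hζ hζ1 h₁ (by simpa using h₂) t
  | insert b s hb ih =>
    have hm := differentiable_phiMul τ
    have hζ0 : ζ ≠ 0 := by rintro rfl; simp at hζ
    obtain ⟨K, hK, hK₁, hK₂, hHK⟩ := exists_eq_Phi_mul hτ hH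
      (u := fun t ↦ ζ * ∏ k ∈ s, phiMul τ (t - a k)) (by fun_prop)
      (fun t ↦ mul_ne_zero hζ0 (Finset.prod_ne_zero_iff.mpr fun k _ ↦ phiMul_ne_zero _ _)) h₁
      (fun t ↦ by rw [h₂, Finset.prod_insert hb]; ring) (h0 b (Finset.mem_insert_self b s))
    rw [hHK, ih (fun i hi j hj ↦ ha i (Finset.mem_insert_of_mem hi) j (Finset.mem_insert_of_mem hj))
      K hK hK₁ hK₂ fun k hk ↦ ?_, mul_zero]
    have h := h0 k (Finset.mem_insert_of_mem hk)
    rw [hHK] at h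
    exact (mul_eq_zero.mp h).resolve_left (Phi_ne_zero hτ (ha k (Finset.mem_insert_of_mem hk) b
      (Finset.mem_insert_self b s) (by rintro rfl; exact hb hk)))

/-- The entire function `invEllf τ N t * Phi τ t`. -/
noncomputable def invEllfNum (τ : ℂ) (N : ℕ) (t : ℂ) : ℂ :=
  Phi τ (t - 2 * Real.pi * I / N) / Phi τ (-(2 * Real.pi * I / N))

/-- The entire function `invEllf τ N (-t) * Phi τ t`. -/
noncomputable def invEllfNegNum (τ : ℂ) (N : ℕ) (t : ℂ) : ℂ :=
  exp (2 * Real.pi * I / N) * Phi τ (t + 2 * Real.pi * I / N) / Phi τ (-(2 * Real.pi * I / N))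

lemma differentiable_invEllfNum {τ : ℂ} (hτ : 0 < τ.im) (N : ℕ) :
    Differentiable ℂ (invEllfNum τ N) := by
  have := differentiable_Phi hτ
  unfold invEllfNum
  fun_prop

lemma differentiable_invEllfNegNum {τ : ℂ} (hτ : 0 < τ.im) (N : ℕ) :
    Differentiable ℂ (invEllfNegNum τ N) := by
  have := differentiable_Phi hτ
  unfold invEllfNegNum
  fun_prop

lemma invEllfNum_add_two_pi_I (τ : ℂ) (N : ℕ) (t : ℂ) :
    invEllfNum τ N (t + 2 * Real.pi * I) = invEllfNum τ N t := by
  rw [invEllfNum, add_sub_right_comm, Phi_add_two_pi_I, invEllfNum]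

lemma invEllfNegNum_add_two_pi_I (τ : ℂ) (N : ℕ) (t : ℂ) :
    invEllfNegNum τ N (t + 2 * Real.pi * I) = invEllfNegNum τ N t := by
  rw [invEllfNegNum, add_right_comm, Phi_add_two_pi_I, invEllfNegNum]

lemma invEllfNum_add_period {τ : ℂ} (hτ : 0 < τ.im) (N : ℕ) (t : ℂ) :
    invEllfNum τ N (t + 2 * Real.pi * I * τ) =
      exp (2 * Real.pi * I / N) * phiMul τ t * invEllfNum τ N t := by
  rw [invEllfNum, add_sub_right_comm, Phi_add_period hτ, phiMul_sub, invEllfNum]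
  ring

lemma invEllfNegNum_add_period {τ : ℂ} (hτ : 0 < τ.im) (N : ℕ) (t : ℂ) :
    invEllfNegNum τ N (t + 2 * Real.pi * I * τ) =
      (exp (2 * Real.pi * I / N))⁻¹ * phiMul τ t * invEllfNegNum τ N t := by
  have h := phiMul_sub τ t (-(2 * Real.pi * I / N))
  rw [sub_neg_eq_add, exp_neg] at h
  rw [invEllfNegNum, add_right_comm, Phi_add_period hτ, h, invEllfNegNum]
  ring

lemma invEllfNum_eq {τ : ℂ} (hτ : 0 < τ.im) (N : ℕ) {t : ℂ} (ht : t ∉ lat τ) :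
    invEllfNum τ N t = invEllf τ N t * Phi τ t := by
  have := Phi_ne_zero hτ ht
  rw [invEllfNum, invEllf, ← div_div, div_right_comm, div_mul_cancel₀ _ this]

lemma invEllfNegNum_eq {τ : ℂ} (hτ : 0 < τ.im) (N : ℕ) {t : ℂ} (ht : t ∉ lat τ) :
    invEllfNegNum τ N t = invEllf τ N (-t) * Phi τ t := by
  have h := Phi_ne_zero hτ ht
  have he := exp_ne_zero t
  rw [invEllfNegNum, invEllf, ← div_div, div_right_comm, ← neg_add', Phi_neg τ (t + _), Phi_neg τ t,
    exp_add]
  field_simp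

lemma Phi_neg_div_ne_zero {τ : ℂ} (hτ : 0 < τ.im) {N : ℕ} (hN : 2 ≤ N) :
    Phi τ (-(2 * Real.pi * I / N)) ≠ 0 :=
  Phi_ne_zero hτ (neg_mem_lat_iff.not.mpr (div_natCast_notMem_lat hτ hN))

lemma invEllfNum_zero {τ : ℂ} (hτ : 0 < τ.im) {N : ℕ} (hN : 2 ≤ N) : invEllfNum τ N 0 = 1 := by
  rw [invEllfNum, zero_sub, div_self (Phi_neg_div_ne_zero hτ hN)]

lemma invEllfNegNum_zero {τ : ℂ} (hτ : 0 < τ.im) {N : ℕ} (hN : 2 ≤ N) :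
    invEllfNegNum τ N 0 = -1 := by
  have h := Phi_neg_div_ne_zero hτ hN
  have h' := Phi_neg τ (2 * Real.pi * I / N)
  rw [invEllfNegNum, zero_add, div_eq_iff h, h']
  ring

lemma exp_two_pi_I_div_pow_eq_one {N n : ℕ} (hN : N ≠ 0) (h : N ∣ n) :
    exp (2 * Real.pi * I / N) ^ n = 1 := by
  obtain ⟨m, rfl⟩ := h
  rw [pow_mul, (Complex.isPrimitiveRoot_exp N hN).pow_eq_one, one_pow]

/-- The numerator of the difference of the two sides of `invEllf_mul_prod_add_sum`. -/
noncomputable def residueNum (τ : ℂ) (N : ℕ) {ι : Type*} [DecidableEq ι] (s : Finset ι)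
    (a : ι → ℂ) (t : ℂ) : ℂ :=
  invEllfNum τ N t * ∏ j ∈ s, invEllfNegNum τ N (t - a j) +
      ∑ k ∈ s, invEllf τ N (a k) * (∏ j ∈ s.erase k, invEllf τ N (a j - a k)) *
        (invEllfNum τ N (t - a k) * (Phi τ t * ∏ j ∈ s.erase k, Phi τ (t - a j))) -
    (∏ j ∈ s, invEllf τ N (a j)) * (invEllfNum τ N t * ∏ j ∈ s, Phi τ (t - a j))

section residueNum

variable {ι : Type*} [DecidableEq ι]

lemma differentiable_residueNum {τ : ℂ} (hτ : 0 < τ.im) (N : ℕ) (s : Finset ι) (a : ι → ℂ) :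
    Differentiable ℂ (residueNum τ N s a) := by
  have h₁ := differentiable_Phi hτ
  have h₂ := differentiable_invEllfNum hτ N
  have h₃ := differentiable_invEllfNegNum hτ N
  unfold residueNum
  fun_prop

lemma residueNum_add_two_pi_I (τ : ℂ) (N : ℕ) (s : Finset ι) (a : ι → ℂ) (t : ℂ) :
    residueNum τ N s a (t + 2 * Real.pi * I) = residueNum τ N s a t := by
  simp only [residueNum, add_sub_right_comm t, invEllfNum_add_two_pi_I,
    invEllfNegNum_add_two_pi_I, Phi_add_two_pi_I]

lemma residueNum_add_period {τ : ℂ} (hτ : 0 < τ.im) {N : ℕ} (hN : N ≠ 0) {s : Finset ι}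
    (hs : N ∣ s.card) (a : ι → ℂ) (t : ℂ) :
    residueNum τ N s a (t + 2 * Real.pi * I * τ) =
      exp (2 * Real.pi * I / N) * (∏ j ∈ s, phiMul τ (t - a j)) * phiMul τ t *
        residueNum τ N s a t := by
  simp only [residueNum, add_sub_right_comm t, invEllfNum_add_period hτ,
    invEllfNegNum_add_period hτ, Phi_add_period hτ, Finset.prod_mul_distrib, Finset.prod_const,
    inv_pow, exp_two_pi_I_div_pow_eq_one hN hs, mul_sub, mul_add, Finset.mul_sum]
  congr 1
  · congr 1
    · ring
    refine Finset.sum_congr rfl fun k hk ↦ ?_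
    rw [← Finset.mul_prod_erase s (fun j ↦ phiMul τ (t - a j)) hk]
    ring
  · ring

lemma residueNum_zero {τ : ℂ} (hτ : 0 < τ.im) (N : ℕ) {s : Finset ι} {a : ι → ℂ}
    (ha0 : ∀ i ∈ s, a i ∉ lat τ) : residueNum τ N s a 0 = 0 := by
  have h : ∏ j ∈ s, invEllfNegNum τ N (0 - a j) =
      (∏ j ∈ s, invEllf τ N (a j)) * ∏ j ∈ s, Phi τ (0 - a j) := by
    rw [← Finset.prod_mul_distrib]
    refine Finset.prod_congr rfl fun j hj ↦ ?_
    rw [zero_sub, invEllfNegNum_eq hτ N (neg_mem_lat_iff.not.mpr (ha0 j hj)), neg_neg]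
  simp only [residueNum, h, Phi_zero, zero_mul, mul_zero, Finset.sum_const_zero]
  ring

lemma residueNum_apply {τ : ℂ} (hτ : 0 < τ.im) {N : ℕ} (hN : 2 ≤ N) {s : Finset ι} {a : ι → ℂ}
    (ha0 : ∀ i ∈ s, a i ∉ lat τ) (ha : ∀ i ∈ s, ∀ j ∈ s, i ≠ j → a i - a j ∉ lat τ) {k : ι}
    (hk : k ∈ s) : residueNum τ N s a (a k) = 0 := by
  have h₁ : ∏ j ∈ s, invEllfNegNum τ N (a k - a j) =
      -((∏ j ∈ s.erase k, invEllf τ N (a j - a k)) * ∏ j ∈ s.erase k, Phi τ (a k - a j)) := by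
    rw [← Finset.mul_prod_erase s _ hk, sub_self, invEllfNegNum_zero hτ hN,
      ← Finset.prod_mul_distrib, neg_one_mul]
    congr 1
    refine Finset.prod_congr rfl fun j hj ↦ ?_
    obtain ⟨hjk, hj⟩ := Finset.mem_erase.mp hj
    rw [invEllfNegNum_eq hτ N (ha k hk j hj hjk.symm), neg_sub]
  have h₂ : ∏ j ∈ s, Phi τ (a k - a j) = 0 :=
    Finset.prod_eq_zero hk (by rw [sub_self, Phi_zero])
  rw [residueNum, h₁, h₂, Finset.sum_eq_single_of_mem k hk, sub_self, invEllfNum_zero hτ hN,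
    invEllfNum_eq hτ N (ha0 k hk)]
  · ring
  · intro l _ hlk
    have h : ∏ j ∈ s.erase l, Phi τ (a k - a j) = 0 :=
      Finset.prod_eq_zero (Finset.mem_erase.mpr ⟨hlk.symm, hk⟩) (by rw [sub_self, Phi_zero])
    rw [h, mul_zero, mul_zero, mul_zero]

lemma residueNum_eq_zero {τ : ℂ} (hτ : 0 < τ.im) {N : ℕ} (hN : 2 ≤ N) {s : Finset ι}
    (hs : N ∣ s.card) {a : ι → ℂ} (ha0 : ∀ i ∈ s, a i ∉ lat τ)
    (ha : ∀ i ∈ s, ∀ j ∈ s, i ≠ j → a i - a j ∉ lat τ) (t : ℂ) : residueNum τ N s a t = 0 := by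
  have hN0 : N ≠ 0 := by omega
  have hm := differentiable_phiMul τ
  have hprim := Complex.isPrimitiveRoot_exp N hN0
  obtain ⟨K, hK, hK₁, hK₂, hHK⟩ := exists_eq_Phi_mul hτ (a := 0)
    (u := fun t ↦ exp (2 * Real.pi * I / N) * ∏ j ∈ s, phiMul τ (t - a j))
    (differentiable_residueNum hτ N s a) (by fun_prop)
    (fun t ↦ mul_ne_zero (exp_ne_zero _) (Finset.prod_ne_zero_iff.mpr fun k _ ↦ phiMul_ne_zero _ _))
    (residueNum_add_two_pi_I τ N s a)
    (fun t ↦ by rw [sub_zero, residueNum_add_period hτ hN0 hs]) (residueNum_zero hτ N ha0)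
  rw [hHK, eq_zero_of_prod_phiMul hτ (hprim.norm'_eq_one hN0) (hprim.ne_one (by omega)) s a ha K hK
    hK₁ hK₂ fun k hk ↦ ?_, mul_zero]
  have h := residueNum_apply hτ hN ha0 ha hk
  rw [hHK, sub_zero] at h
  exact (mul_eq_zero.mp h).resolve_left (Phi_ne_zero hτ (ha0 k hk))

/-- The residue theorem for the elliptic function `z ↦ invEllf z * ∏ j ∈ s, invEllf (a j - z)`,
as a partial fraction expansion. -/
lemma invEllf_mul_prod_add_sum {τ : ℂ} (hτ : 0 < τ.im) {N : ℕ} (hN : 2 ≤ N) {s : Finset ι}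
    (hs : N ∣ s.card) {a : ι → ℂ} (ha0 : ∀ i ∈ s, a i ∉ lat τ)
    (ha : ∀ i ∈ s, ∀ j ∈ s, i ≠ j → a i - a j ∉ lat τ) {t : ℂ} (ht : t ∉ lat τ)
    (hta : ∀ i ∈ s, t - a i ∉ lat τ) :
    invEllf τ N t * ∏ j ∈ s, invEllf τ N (a j - t) +
        ∑ k ∈ s, invEllf τ N (a k) *
          (invEllf τ N (t - a k) * ∏ j ∈ s.erase k, invEllf τ N (a j - a k)) =
      invEllf τ N t * ∏ j ∈ s, invEllf τ N (a j) := by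
  have h := residueNum_eq_zero hτ hN hs ha0 ha t
  have hP : Phi τ t * ∏ j ∈ s, Phi τ (t - a j) ≠ 0 :=
    mul_ne_zero (Phi_ne_zero hτ ht)
      (Finset.prod_ne_zero_iff.mpr fun j hj ↦ Phi_ne_zero hτ (hta j hj))
  have h₁ : ∏ j ∈ s, invEllfNegNum τ N (t - a j) =
      (∏ j ∈ s, invEllf τ N (a j - t)) * ∏ j ∈ s, Phi τ (t - a j) := by
    rw [← Finset.prod_mul_distrib]
    refine Finset.prod_congr rfl fun j hj ↦ ?_
    rw [invEllfNegNum_eq hτ N (hta j hj), neg_sub]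
  have h₂ : ∑ k ∈ s, invEllf τ N (a k) * (∏ j ∈ s.erase k, invEllf τ N (a j - a k)) *
        (invEllfNum τ N (t - a k) * (Phi τ t * ∏ j ∈ s.erase k, Phi τ (t - a j))) =
      (∑ k ∈ s, invEllf τ N (a k) *
        (invEllf τ N (t - a k) * ∏ j ∈ s.erase k, invEllf τ N (a j - a k))) *
        (Phi τ t * ∏ j ∈ s, Phi τ (t - a j)) := by
    rw [Finset.sum_mul]
    refine Finset.sum_congr rfl fun k hk ↦ ?_
    rw [invEllfNum_eq hτ N (hta k hk), ← Finset.mul_prod_erase s (fun j ↦ Phi τ (t - a j)) hk]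
    ring
  rw [residueNum, h₁, h₂, invEllfNum_eq hτ N ht] at h
  apply mul_right_cancel₀ hP
  linear_combination h

end residueNum

/-- If `q ≡ 1 (mod N)`, `q ≥ 1`, and `x₁,…,x_q` are pairwise incongruent mod `L(τ)`
with no `xᵢ` in `L(τ)`, then
`∑ᵢ (1/f(xᵢ)) ∏_{j≠i} 1/f(x_j − xᵢ) = ∏ᵢ 1/f(xᵢ)`. -/
theorem sum_invEllf_eq_prod_invEllf (τ : ℂ) (hτ : 0 < τ.im) (N : ℕ) (hN : 2 ≤ N)
    (q : ℕ) (hq : 1 ≤ q) (hqN : q % N = 1) (x : Fin q → ℂ)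
    (hx0 : ∀ i, x i ∉ lat τ)
    (hxd : ∀ i j, i ≠ j → x i - x j ∉ lat τ) :
    ∑ i : Fin q,
        invEllf τ N (x i) * ∏ j ∈ Finset.univ.erase i, invEllf τ N (x j - x i) =
      ∏ i : Fin q, invEllf τ N (x i) := by
  have hcard : N ∣ (Finset.univ.erase (⟨0, hq⟩ : Fin q)).card := by
    rw [Finset.card_erase_of_mem (Finset.mem_univ _), Finset.card_univ, Fintype.card_fin, ← hqN]
    exact Nat.dvd_sub_mod q
  have key := invEllf_mul_prod_add_sum hτ hN hcard (a := x) (fun i _ ↦ hx0 i)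
    (fun i _ j _ hij ↦ hxd i j hij) (hx0 ⟨0, hq⟩)
    (fun i hi ↦ hxd _ i (Finset.ne_of_mem_erase hi).symm)
  rw [← Finset.mul_prod_erase Finset.univ (fun i ↦ invEllf τ N (x i)) (Finset.mem_univ ⟨0, hq⟩),
    ← key, ← Finset.add_sum_erase _ _ (Finset.mem_univ (⟨0, hq⟩ : Fin q))]
  congr 1
  refine Finset.sum_congr rfl fun k hk ↦ ?_
  have hmem : (⟨0, hq⟩ : Fin q) ∈ Finset.univ.erase k :=
    Finset.mem_erase.mpr ⟨(Finset.ne_of_mem_erase hk).symm, Finset.mem_univ _⟩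
  rw [← Finset.mul_prod_erase _ _ hmem, Finset.erase_right_comm]
end

section
/- For every τ ∈ ℍ, the function x ↦ Φ(τ,x) is entire, i.e. complex analytic at every point of ℂ. -/
open Complex

/-- The `n`-th factor of the product defining `Phi`, written as `1` plus a geometrically small
term. -/
lemma phi_factor_eq_one_add {Q : ℂ} (hQ : 1 - Q ≠ 0) (y : ℂ) :
    (1 - Q * exp (-y)) * (1 - Q * exp y) / (1 - Q) ^ 2 =
      1 + Q * (2 - exp (-y) - exp y) / (1 - Q) ^ 2 := by
  have h : exp (-y) * exp y = 1 := by rw [← exp_add]; simp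
  field_simp
  linear_combination Q ^ 2 * h

lemma one_sub_norm_le_norm_one_sub_pow {q : ℂ} (hq : ‖q‖ < 1) (n : ℕ) :
    1 - ‖q‖ ≤ ‖1 - q ^ (n + 1)‖ := by
  have h₁ : ‖q ^ (n + 1)‖ ≤ ‖q‖ := by
    rw [norm_pow]
    exact pow_le_of_le_one (norm_nonneg q) hq.le n.succ_ne_zero
  have h₂ := norm_sub_norm_le (1 : ℂ) (q ^ (n + 1))
  rw [norm_one] at h₂
  linarith

lemma norm_two_sub_exp_neg_sub_exp_le {R : ℝ} {y : ℂ} (hy : ‖y‖ ≤ R) :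
    ‖2 - exp (-y) - exp y‖ ≤ 2 + 2 * Real.exp R := by
  have h₁ : ‖exp y‖ ≤ Real.exp R :=
    (norm_exp_le_exp_norm y).trans (Real.exp_le_exp.mpr hy)
  have h₂ : ‖exp (-y)‖ ≤ Real.exp R :=
    (norm_exp_le_exp_norm (-y)).trans (Real.exp_le_exp.mpr (by rwa [norm_neg]))
  have h₃ := norm_sub_le (2 - exp (-y)) (exp y)
  have h₄ := norm_sub_le (2 : ℂ) (exp (-y))
  rw [Complex.norm_ofNat] at h₄
  linarith

/-- For `‖q‖ < 1`, the infinite product in the definition of `Phi` is an entire function. -/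
lemma differentiable_tprod_phi_factor {q : ℂ} (hq : ‖q‖ < 1) :
    Differentiable ℂ fun y : ℂ ↦ ∏' n : ℕ,
      ((1 - q ^ (n + 1) * exp (-y)) * (1 - q ^ (n + 1) * exp y) / (1 - q ^ (n + 1)) ^ 2) := by
  have hpos : 0 < 1 - ‖q‖ := sub_pos.mpr hq
  have hne (n : ℕ) : 1 - q ^ (n + 1) ≠ 0 :=
    norm_pos_iff.mp (hpos.trans_le (one_sub_norm_le_norm_one_sub_pow hq n))
  simp_rw [phi_factor_eq_one_add (hne _)]
  intro x
  set R : ℝ := ‖x‖ + 1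
  have hu : Summable fun n : ℕ ↦
      ‖q‖ ^ (n + 1) * (2 + 2 * Real.exp R) / (1 - ‖q‖) ^ 2 :=
    (((summable_nat_add_iff 1).mpr
      (summable_geometric_of_lt_one (norm_nonneg q) hq)).mul_right _).div_const _
  have hprod := hu.hasProdLocallyUniformlyOn_nat_one_add (K := Metric.ball (0 : ℂ) R)
    (f := fun n y ↦ q ^ (n + 1) * (2 - exp (-y) - exp y) / (1 - q ^ (n + 1)) ^ 2)
    Metric.isOpen_ball (.of_forall fun n y hy ↦ by
      rw [norm_div, norm_mul, norm_pow, norm_pow]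
      gcongr
      · exact norm_two_sub_exp_neg_sub_exp_le (mem_ball_zero_iff.mp hy).le
      · exact one_sub_norm_le_norm_one_sub_pow hq n)
    (fun n ↦ by fun_prop)
  have hdiff := hprod.differentiableOn
    (.of_forall fun _ ↦ by simpa [Finset.prod_fn] using
      DifferentiableOn.finsetProd (fun _ _ ↦ by fun_prop)) Metric.isOpen_ball
  exact hdiff.differentiableAt (Metric.isOpen_ball.mem_nhds (by simp [R]))

/-- For `τ` in the upper half-plane, `x ↦ Φ(τ,x)` is entire: it is complex
analytic at every point of `ℂ`. -/
theorem phi_entire (τ : ℂ) (hτ : 0 < τ.im) :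
    ∀ x : ℂ, AnalyticAt ℂ (fun y : ℂ => Phi τ y) x := by
  have hq : ‖exp (2 * Real.pi * I * τ)‖ < 1 := UpperHalfPlane.norm_exp_two_pi_I_lt_one ⟨τ, hτ⟩
  have hΦ : Differentiable ℂ fun y : ℂ ↦ Phi τ y :=
    Differentiable.mul (by fun_prop) (differentiable_tprod_phi_factor hq)
  exact fun x ↦ hΦ.analyticAt x
end

section
/- For every τ ∈ ℍ and every x ∈ ℂ one has the quasi-periodicity Φ(τ, x + 2πiτ) = −e^{−2πiτ}·e^{−x}·Φ(τ, x). -/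
open Complex

lemma multipliable_one_sub_pow_succ_mul {q : ℂ} (hq : ‖q‖ < 1) (a : ℂ) :
    Multipliable fun n : ℕ ↦ 1 - q ^ (n + 1) * a := by
  simp_rw [sub_eq_add_neg]
  apply multipliable_one_add_of_summable
  simpa using ((summable_nat_add_iff 1).mpr
    (summable_geometric_of_lt_one (norm_nonneg _) hq)).mul_right ‖a‖

lemma tprod_one_sub_pow_succ_mul {q : ℂ} (hq : ‖q‖ < 1) (a : ℂ) :
    ∏' n : ℕ, (1 - q ^ (n + 1) * a) = (1 - q * a) * ∏' n : ℕ, (1 - q ^ (n + 1) * (q * a)) := by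
  have h : ∀ n : ℕ, 1 - q ^ (n + 1) * (q * a) = 1 - q ^ (n + 1 + 1) * a := fun n ↦ by ring
  have hm := multipliable_one_sub_pow_succ_mul hq (q * a)
  simp_rw [h] at hm ⊢
  simpa using tprod_eq_zero_mul' (f := fun n : ℕ ↦ 1 - q ^ (n + 1) * a) hm

lemma tprod_one_sub_pow_succ_ne_zero {q : ℂ} (hq : ‖q‖ < 1) :
    ∏' n : ℕ, (1 - q ^ (n + 1)) ≠ 0 := by
  simp_rw [sub_eq_add_neg]
  refine tprod_one_add_ne_zero_of_summable (fun n h ↦ ?_) ?_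
  · have hlt : ‖q ^ (n + 1)‖ < 1 := by
      rw [norm_pow]
      exact pow_lt_one₀ (norm_nonneg _) hq n.succ_ne_zero
    rw [← sub_eq_add_neg, sub_eq_zero] at h
    simp [← h] at hlt
  · simpa using (summable_nat_add_iff 1).mpr (summable_geometric_of_lt_one (norm_nonneg _) hq)

lemma tprod_one_sub_mul_one_sub_div {q : ℂ} (hq : ‖q‖ < 1) (a b : ℂ) :
    ∏' n : ℕ, ((1 - q ^ (n + 1) * a) * (1 - q ^ (n + 1) * b) / (1 - q ^ (n + 1)) ^ 2) =
      (∏' n : ℕ, (1 - q ^ (n + 1) * a)) * (∏' n : ℕ, (1 - q ^ (n + 1) * b)) /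
        (∏' n : ℕ, (1 - q ^ (n + 1))) ^ 2 := by
  have hD : Multipliable fun n : ℕ ↦ 1 - q ^ (n + 1) := by
    simpa using multipliable_one_sub_pow_succ_mul hq 1
  have h0 := tprod_one_sub_pow_succ_ne_zero hq
  have hab := (multipliable_one_sub_pow_succ_mul hq a).hasProd.mul
    (multipliable_one_sub_pow_succ_mul hq b).hasProd
  simpa only [← pow_two] using
    (hab.div₀ (hD.hasProd.mul hD.hasProd) (mul_ne_zero h0 h0)).tprod_eq

lemma norm_exp_two_pi_I_mul_lt_one {τ : ℂ} (hτ : 0 < τ.im) :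
    ‖Complex.exp (2 * Real.pi * Complex.I * τ)‖ < 1 :=
  UpperHalfPlane.norm_exp_two_pi_I_lt_one ⟨τ, hτ⟩

/-- Quasi-periodicity: `Φ(τ, x + 2πiτ) = −e^{−2πiτ}·e^{−x}·Φ(τ, x)`. -/
theorem phi_quasiperiodic (τ : ℂ) (hτ : 0 < τ.im) (x : ℂ) :
    Phi τ (x + 2 * Real.pi * Complex.I * τ) =
      -Complex.exp (-(2 * Real.pi * Complex.I * τ)) * Complex.exp (-x) * Phi τ x := by
  have hq := norm_exp_two_pi_I_mul_lt_one hτ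
  have hq0 := Complex.exp_ne_zero (2 * Real.pi * Complex.I * τ)
  have hx0 := Complex.exp_ne_zero x
  simp only [Phi, tprod_one_sub_mul_one_sub_div hq, neg_add, Complex.exp_add, Complex.exp_neg]
  set q := Complex.exp (2 * Real.pi * Complex.I * τ)
  set w := Complex.exp x
  rw [tprod_one_sub_pow_succ_mul hq (w⁻¹ * q⁻¹), tprod_one_sub_pow_succ_mul hq w,
    mul_comm w q, show q * (w⁻¹ * q⁻¹) = w⁻¹ by field_simp]
  have key : 1 - w⁻¹ * q⁻¹ = -q⁻¹ * w⁻¹ * (1 - q * w) := by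
    field_simp
    ring
  rw [key]
  ring
end

section
/- Let φ₁, …, φ_s ∈ R be weighted-homogeneous of weighted degrees r₁, …, r_s ≥ 1 such that for each 1 ≤ i ≤ s the ideal quotient satisfies (⟨φ₁,…,φ_{i−1}⟩ : φ_i) = ⟨φ₁,…,φ_{i−1}⟩. Then, with I = ⟨φ₁,…,φ_s⟩, the identity (∑_{n≥0} dim(R/I)^{(n)} · tⁿ) · ∏_{i=1}^{k} (1 − t^{d_i}) = ∏_{j=1}^{s} (1 − t^{r_j}) holds in the formal power series ring ℤ[[t]]. -/
/-- The dimension `dim(R/I)^{(n)}`: the `ℂ`-dimension of the image in `R/I` of the space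
of weighted-homogeneous polynomials of weighted degree `n`, where `R = ℂ[x₁,…,x_k]` is
weighted by `d`. -/
noncomputable def gradedDim {k : ℕ} (d : Fin k → ℕ)
    (I : Ideal (MvPolynomial (Fin k) ℂ)) (n : ℕ) : ℕ :=
  Module.finrank ℂ
    ((MvPolynomial.weightedHomogeneousSubmodule ℂ d n).map
      (Ideal.Quotient.mkₐ ℂ I).toLinearMap)

section

open MvPolynomial

attribute [local instance] MvPolynomial.weightedGradedAlgebra

/-- The weighted degree `m` part of a product `b * φ` with `φ` weighted-homogeneous of degree `r`
is a multiple of `φ` by a weighted-homogeneous polynomial of degree `m - r`, and vanishes when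
`m < r`. -/
theorem weightedHomogeneousComponent_mul_of_isWeightedHomogeneous {σ : Type*} {w : σ → ℕ}
    {φ : MvPolynomial σ ℂ} {r : ℕ} (hφ : IsWeightedHomogeneous w φ r)
    (b : MvPolynomial σ ℂ) (m : ℕ) :
    weightedHomogeneousComponent w m (b * φ) =
      if r ≤ m then weightedHomogeneousComponent w (m - r) b * φ else 0 := by
  have h := DirectSum.coe_decompose_mul_of_right_mem (weightedHomogeneousSubmodule ℂ w)
    (a := b) (b := φ) (i := r) m hφ
  have hcomp (f : MvPolynomial σ ℂ) (n : ℕ) :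
      (DirectSum.decompose (weightedHomogeneousSubmodule ℂ w) f n : MvPolynomial σ ℂ) =
        weightedHomogeneousComponent w n f := weightedDecomposition.decompose'_apply ℂ w f n
  rwa [hcomp, hcomp] at h

/-- Rank-nullity for the restriction of a linear map to a subspace. -/
theorem Submodule.finrank_map_add_finrank_inf_ker {K V W : Type*} [Field K] [AddCommGroup V]
    [Module K V] [AddCommGroup W] [Module K W] (f : V →ₗ[K] W) (p : Submodule K V)
    [Module.Finite K p] :
    Module.finrank K (p.map f) + Module.finrank K ↥(p ⊓ LinearMap.ker f) =
      Module.finrank K p := by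
  have h := LinearMap.finrank_range_add_finrank_ker (f.domRestrict p)
  rw [LinearMap.range_domRestrict, LinearMap.ker_domRestrict] at h
  rw [← h, ← Submodule.finrank_map_subtype_eq, Submodule.map_comap_subtype]

variable {k : ℕ} {d : Fin k → ℕ}

theorem weightedHomogeneousSubmodule_finite (hd : ∀ i, 1 ≤ d i) (n : ℕ) :
    Module.Finite ℂ (weightedHomogeneousSubmodule ℂ d n) :=
  Module.Finite.iff_fg.mpr
    (weightedHomogeneousSubmodule_fg ℂ d (fun i => Nat.one_le_iff_ne_zero.mp (hd i)) n)

theorem gradedDim_add_finrank_inf (hd : ∀ i, 1 ≤ d i) (I : Ideal (MvPolynomial (Fin k) ℂ))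
    (n : ℕ) :
    gradedDim d I n +
        Module.finrank ℂ ↥(weightedHomogeneousSubmodule ℂ d n ⊓ I.restrictScalars ℂ) =
      Module.finrank ℂ (weightedHomogeneousSubmodule ℂ d n) := by
  have := weightedHomogeneousSubmodule_finite hd n
  have hker : LinearMap.ker (Ideal.Quotient.mkₐ ℂ I).toLinearMap = I.restrictScalars ℂ := by
    ext x
    simp [Ideal.Quotient.eq_zero_iff_mem]
  have h := Submodule.finrank_map_add_finrank_inf_ker (Ideal.Quotient.mkₐ ℂ I).toLinearMap
    (weightedHomogeneousSubmodule ℂ d n)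
  rwa [hker] at h

/-- A weighted-homogeneous element of `⟨φ⟩ + I` is the sum of one of `I` and a
homogeneous multiple of `φ`. -/
theorem exists_mul_sub_mem_of_isWeightedHomogeneous {I : Ideal (MvPolynomial (Fin k) ℂ)}
    (hI : I.IsHomogeneous (weightedHomogeneousSubmodule ℂ d)) {φ : MvPolynomial (Fin k) ℂ}
    {r m : ℕ} (hφ : IsWeightedHomogeneous d φ r) {p : MvPolynomial (Fin k) ℂ}
    (hp : IsWeightedHomogeneous d p m) (hpJ : p ∈ Ideal.span {φ} ⊔ I) :
    ∃ b, (if r ≤ m then weightedHomogeneousComponent d (m - r) b * φ else 0) - p ∈ I := by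
  obtain ⟨b, a, ha, rfl⟩ := Ideal.mem_span_singleton_sup.mp hpJ
  refine ⟨b, ?_⟩
  have h := weightedHomogeneousComponent_eq_self hp
  rw [map_add, weightedHomogeneousComponent_mul_of_isWeightedHomogeneous hφ] at h
  rw [← h, sub_add_cancel_left]
  exact I.neg_mem (weightedHomogeneousComponent_mem_of_mem ℂ d hI ha m)

theorem gradedDim_span_singleton_sup_of_lt (hd : ∀ i, 1 ≤ d i)
    {I : Ideal (MvPolynomial (Fin k) ℂ)}
    (hI : I.IsHomogeneous (weightedHomogeneousSubmodule ℂ d)) {φ : MvPolynomial (Fin k) ℂ}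
    {r m : ℕ} (hφ : IsWeightedHomogeneous d φ r) (hm : m < r) :
    gradedDim d (Ideal.span {φ} ⊔ I) m = gradedDim d I m := by
  have h₁ := gradedDim_add_finrank_inf hd I m
  have h₂ := gradedDim_add_finrank_inf hd (Ideal.span {φ} ⊔ I) m
  have h : weightedHomogeneousSubmodule ℂ d m ⊓ (Ideal.span {φ} ⊔ I).restrictScalars ℂ =
      weightedHomogeneousSubmodule ℂ d m ⊓ I.restrictScalars ℂ := by
    apply le_antisymm
    · rintro p ⟨hp, hpJ⟩
      obtain ⟨b, hb⟩ := exists_mul_sub_mem_of_isWeightedHomogeneous hI hφ hp hpJ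
      rw [if_neg hm.not_ge, zero_sub] at hb
      exact ⟨hp, neg_mem_iff.mp hb⟩
    · exact inf_le_inf_left _ fun x hx => Ideal.mem_sup_right (S := Ideal.span {φ}) hx
  rw [h] at h₂
  omega

/-- The degree `n + r` part of `(⟨φ⟩ + I) / I` is isomorphic, via multiplication by `φ`, to the
degree `n` part of `R / I`. -/
theorem gradedDim_span_singleton_sup_add (hd : ∀ i, 1 ≤ d i)
    {I : Ideal (MvPolynomial (Fin k) ℂ)}
    (hI : I.IsHomogeneous (weightedHomogeneousSubmodule ℂ d)) {φ : MvPolynomial (Fin k) ℂ}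
    {r : ℕ} (hφ : IsWeightedHomogeneous d φ r) (hreg : I.colon (Ideal.span {φ}) = I) (n : ℕ) :
    gradedDim d (Ideal.span {φ} ⊔ I) (n + r) + gradedDim d I n = gradedDim d I (n + r) := by
  have hfin := weightedHomogeneousSubmodule_finite hd
  set J := Ideal.span {φ} ⊔ I
  let W := weightedHomogeneousSubmodule ℂ d
  let P := W (n + r) ⊓ J.restrictScalars ℂ
  let q := (Ideal.Quotient.mkₐ ℂ I).toLinearMap
  have hker : LinearMap.ker q = I.restrictScalars ℂ := by
    ext x
    simp [q, Ideal.Quotient.eq_zero_iff_mem]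
  have hPfin : Module.Finite ℂ P := Submodule.finiteDimensional_of_le inf_le_left
  have hmap : P.map q = (W n).map (q ∘ₗ LinearMap.mulRight ℂ φ) := by
    apply le_antisymm
    · rintro _ ⟨p, ⟨hp, hpJ⟩, rfl⟩
      obtain ⟨b, hb⟩ := exists_mul_sub_mem_of_isWeightedHomogeneous hI hφ hp hpJ
      rw [if_pos (Nat.le_add_left r n), Nat.add_sub_cancel] at hb
      exact ⟨_, weightedHomogeneousComponent_mem d b n, Ideal.Quotient.eq.mpr hb⟩
    · rintro _ ⟨b, hb, rfl⟩
      exact ⟨b * φ, ⟨IsWeightedHomogeneous.mul hb hφ, Ideal.mem_sup_left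
        (Ideal.mul_mem_left _ _ (Ideal.mem_span_singleton_self φ))⟩, rfl⟩
  have hkermul : LinearMap.ker (q ∘ₗ LinearMap.mulRight ℂ φ) = I.restrictScalars ℂ := by
    ext x
    rw [LinearMap.ker_comp, hker, Submodule.restrictScalars_mem]
    conv_rhs => rw [← hreg, Ideal.mem_colon_span_singleton]
    rfl
  have hPI : P ⊓ I.restrictScalars ℂ = W (n + r) ⊓ I.restrictScalars ℂ := by
    have hIJ : I.restrictScalars ℂ ≤ J.restrictScalars ℂ :=
      fun x hx => Ideal.mem_sup_right (S := Ideal.span {φ}) hx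
    rw [inf_assoc, inf_eq_right.mpr hIJ]
  have h₁ := Submodule.finrank_map_add_finrank_inf_ker q P
  have h₂ := Submodule.finrank_map_add_finrank_inf_ker (q ∘ₗ LinearMap.mulRight ℂ φ) (W n)
  rw [hker, hmap, hPI] at h₁
  rw [hkermul] at h₂
  have h₃ := gradedDim_add_finrank_inf hd I n
  have h₄ := gradedDim_add_finrank_inf hd I (n + r)
  have h₅ := gradedDim_add_finrank_inf hd J (n + r)
  simp only [W, P] at h₁ h₂
  omega

/-- The Poincaré series of `R / I` for the weights `d`. -/
noncomputable def poincareSeries (d : Fin k → ℕ) (I : Ideal (MvPolynomial (Fin k) ℂ)) :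
    PowerSeries ℤ :=
  PowerSeries.mk fun n => (gradedDim d I n : ℤ)

theorem poincareSeries_span_singleton_sup (hd : ∀ i, 1 ≤ d i)
    {I : Ideal (MvPolynomial (Fin k) ℂ)}
    (hI : I.IsHomogeneous (weightedHomogeneousSubmodule ℂ d)) {φ : MvPolynomial (Fin k) ℂ}
    {r : ℕ} (hφ : IsWeightedHomogeneous d φ r) (hreg : I.colon (Ideal.span {φ}) = I) :
    poincareSeries d (Ideal.span {φ} ⊔ I) = poincareSeries d I * (1 - PowerSeries.X ^ r) := by
  ext m
  rw [mul_sub, mul_one, map_sub, PowerSeries.coeff_mul_X_pow']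
  simp only [poincareSeries, PowerSeries.coeff_mk]
  split_ifs with h
  · have := gradedDim_span_singleton_sup_add hd hI hφ hreg (m - r)
    rw [Nat.sub_add_cancel h] at this
    omega
  · rw [gradedDim_span_singleton_sup_of_lt hd hI hφ (not_le.mp h), sub_zero]

theorem poincareSeries_span_range (hd : ∀ i, 1 ≤ d i) (s : ℕ)
    (φ : Fin s → MvPolynomial (Fin k) ℂ) (r : Fin s → ℕ)
    (hφ : ∀ j, IsWeightedHomogeneous d (φ j) (r j))
    (hreg : ∀ i : Fin s,
        (Ideal.span (φ '' {j : Fin s | j < i})).colon (Ideal.span {φ i}) =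
          Ideal.span (φ '' {j : Fin s | j < i})) :
    poincareSeries d (Ideal.span (Set.range φ)) =
      poincareSeries d ⊥ * ∏ j : Fin s, (1 - PowerSeries.X ^ r j) := by
  induction s with
  | zero => simp
  | succ s ih =>
    have himage (i : Fin s) : φ '' {j | j < i.castSucc} =
        (fun j : Fin s => φ j.castSucc) '' {j | j < i} := by
      ext x
      simp [Fin.exists_fin_succ', (Fin.castSucc_lt_last i).not_gt]
    have hlast : φ '' {j | j < Fin.last s} = Set.range fun j : Fin s => φ j.castSucc := by
      ext x
      simp [Fin.exists_fin_succ', Fin.castSucc_lt_last]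
    have hrange : Set.range φ = {φ (Fin.last s)} ∪ Set.range fun j : Fin s => φ j.castSucc := by
      ext x
      simp [Fin.exists_fin_succ', or_comm, eq_comm]
    rw [Fin.prod_univ_castSucc, ← mul_assoc,
      ← ih (fun j => φ j.castSucc) (fun j => r j.castSucc) (fun j => hφ _)
        (fun i => by simpa only [himage] using hreg i.castSucc),
      hrange, Ideal.span_union]
    refine poincareSeries_span_singleton_sup hd ?_ (hφ _) ?_
    · refine Ideal.homogeneous_span _ _ ?_
      rintro _ ⟨j, rfl⟩
      exact ⟨_, hφ j.castSucc⟩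
    · simpa only [hlast] using hreg (Fin.last s)

/-- The variable `X i` is a nonzerodivisor modulo any set of other variables. -/
theorem span_X_image_colon_span_X {σ R : Type*} [CommRing R] {t : Set σ} {i : σ} (hi : i ∉ t) :
    (Ideal.span (X '' t : Set (MvPolynomial σ R))).colon (Ideal.span {(X i : MvPolynomial σ R)}) =
      Ideal.span (X '' t) := by
  refine le_antisymm (fun f hf => ?_) Ideal.le_colon
  rw [Ideal.mem_colon_span_singleton, mem_ideal_span_X_image] at hf
  rw [mem_ideal_span_X_image]
  intro m hm
  obtain ⟨j, hj, hne⟩ := hf (m + Finsupp.single i 1) (by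
    rw [mem_support_iff, coeff_mul_X]
    exact mem_support_iff.mp hm)
  refine ⟨j, hj, ?_⟩
  have hij : i ≠ j := fun h => hi (h ▸ hj)
  simpa [Finsupp.single_eq_of_ne hij.symm] using hne

theorem poincareSeries_span_range_X :
    poincareSeries d (Ideal.span (Set.range X)) = 1 := by
  ext n
  rw [poincareSeries, PowerSeries.coeff_mk, PowerSeries.coeff_one]
  have hmem (f : MvPolynomial (Fin k) ℂ) :
      f ∈ Ideal.span (Set.range X) ↔ ∀ m ∈ f.support, ∃ i, m i ≠ 0 := by
    rw [← Set.image_univ, mem_ideal_span_X_image]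
    simp
  have hmap_le : (weightedHomogeneousSubmodule ℂ d n).map
      (Ideal.Quotient.mkₐ ℂ (Ideal.span (Set.range X))).toLinearMap ≤
        if n = 0 then ℂ ∙ 1 else ⊥ := by
    rintro _ ⟨f, hf, rfl⟩
    split_ifs with hn
    · refine Submodule.mem_span_singleton.mpr ⟨coeff 0 f, ?_⟩
      refine Eq.trans ?_ (Ideal.Quotient.eq (x := C (coeff 0 f)) (y := f)|>.mpr ?_)
      · rw [← mul_one (C _), ← MvPolynomial.smul_eq_C_mul]
        rfl
      · rw [hmem]
        intro m hm
        by_contra! h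
        obtain rfl : m = 0 := Finsupp.ext h
        simp at hm
    · refine (Submodule.mem_bot _).mpr (Ideal.Quotient.eq_zero_iff_mem.mpr ?_)
      rw [hmem]
      intro m hm
      by_contra! h
      obtain rfl : m = 0 := Finsupp.ext h
      exact hn (by simpa using (hf (mem_support_iff.mp hm)).symm)
  split_ifs at hmap_le ⊢ with hn
  · subst hn
    have hone : (1 : MvPolynomial (Fin k) ℂ ⧸
        (Ideal.span (Set.range X) : Ideal (MvPolynomial (Fin k) ℂ))) ≠ 0 := by
      intro h
      obtain ⟨i, hi⟩ := (hmem 1).mp (Ideal.Quotient.eq_zero_iff_mem.mp h) 0 (by simp)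
      exact hi rfl
    rw [gradedDim, le_antisymm hmap_le, finrank_span_singleton hone, Nat.cast_one]
    rw [Submodule.span_singleton_le_iff_mem]
    exact ⟨1, isWeightedHomogeneous_one ℂ d, rfl⟩
  · rw [gradedDim, le_bot_iff.mp hmap_le, finrank_bot, Nat.cast_zero]

theorem poincareSeries_bot_mul_prod (hd : ∀ i, 1 ≤ d i) :
    poincareSeries d ⊥ * ∏ i : Fin k, (1 - PowerSeries.X ^ d i) = 1 := by
  rw [← poincareSeries_span_range hd k X d (fun i => isWeightedHomogeneous_X ℂ d i)
    (fun i => span_X_image_colon_span_X (lt_irrefl i)), poincareSeries_span_range_X]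

end

/-- If `φ₁,…,φ_s` are weighted-homogeneous of weighted degrees `r₁,…,r_s ≥ 1` and form a
regular-type sequence `(⟨φ₁,…,φ_{i−1}⟩ : φ_i) = ⟨φ₁,…,φ_{i−1}⟩`, then with
`I = ⟨φ₁,…,φ_s⟩` one has, in `ℤ[[t]]`,
`(∑_{n≥0} dim(R/I)^{(n)} tⁿ) ∏_{i=1}^{k} (1 − t^{dᵢ}) = ∏_{j=1}^{s} (1 − t^{r_j})`. -/
theorem poincareSeries_of_regular_sequence (k : ℕ) (hk : 1 ≤ k) (d : Fin k → ℕ)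
    (hd : ∀ i, 1 ≤ d i) (s : ℕ) (φ : Fin s → MvPolynomial (Fin k) ℂ)
    (r : Fin s → ℕ) (hr : ∀ j, 1 ≤ r j)
    (hφ : ∀ j, MvPolynomial.IsWeightedHomogeneous d (φ j) (r j))
    (hreg : ∀ i : Fin s,
        (Ideal.span (φ '' {j : Fin s | j < i})).colon (Ideal.span {φ i}) =
          Ideal.span (φ '' {j : Fin s | j < i})) :
    (PowerSeries.mk fun n : ℕ =>
        (gradedDim d (Ideal.span (Set.range φ)) n : ℤ)) *
        ∏ i : Fin k, (1 - PowerSeries.X ^ d i) =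
      ∏ j : Fin s, (1 - PowerSeries.X ^ r j) := by
  rw [← poincareSeries, poincareSeries_span_range hd s φ r hφ hreg, mul_right_comm,
    poincareSeries_bot_mul_prod hd, one_mul]
end

section
/- For all τ, τ′ ∈ ℍ the following are equivalent: (i) there exists γ ∈ Γ₁(N) with γ·τ = τ′; (ii) there exists μ ∈ ℂ with μ ≠ 0 such that μ·L(τ) = L(τ′) and μ·(2πi/N) − 2πi/N ∈ L(τ′). (This is the injectivity statement of the bijection between ℍ/Γ₁(N) and homothety classes of pairs consisting of a lattice together with a primitive N-division point, given by τ ↦ (2πi(ℤτ+ℤ), 2πi/N).) -/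
/-- The lattice `L(σ)`: the additive subgroup of `ℂ` generated by `2πiσ` and `2πi`. -/
noncomputable def latSub (σ : ℂ) : AddSubgroup ℂ :=
  AddSubgroup.closure {2 * Real.pi * Complex.I * σ, 2 * Real.pi * Complex.I}

theorem mem_latSub {σ z : ℂ} :
    z ∈ latSub σ ↔ ∃ m n : ℤ, 2 * Real.pi * Complex.I * (m * σ + n) = z := by
  simp only [latSub, AddSubgroup.mem_closure_pair, zsmul_eq_mul]
  refine exists_congr fun m => exists_congr fun n => ?_
  rw [show 2 * Real.pi * Complex.I * (m * σ + n) =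
    (m : ℂ) * (2 * Real.pi * Complex.I * σ) + n * (2 * Real.pi * Complex.I) by ring]

theorem int_coords_unique {σ : ℂ} (hσ : 0 < σ.im) {m n m' n' : ℤ}
    (h : (m : ℂ) * σ + n = m' * σ + n') : m = m' ∧ n = n' := by
  have him := congrArg Complex.im h
  simp only [Complex.add_im, Complex.mul_im, Complex.intCast_re, Complex.intCast_im, zero_mul,
    add_zero] at him
  have hm : m = m' := by exact_mod_cast mul_right_cancel₀ hσ.ne' him
  subst hm
  exact ⟨rfl, by exact_mod_cast add_left_cancel h⟩

theorem moebius_denom_ne_zero {a b c d : ℤ} (hdet : a * d - b * c = 1) {τ : ℂ} (hτ : 0 < τ.im) :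
    (c : ℂ) * τ + d ≠ 0 := by
  intro h
  obtain ⟨rfl, rfl⟩ := int_coords_unique hτ (m' := 0) (n' := 0) (by simpa using h)
  simp at hdet

/-- A real Möbius relation between points of the upper half-plane has positive determinant. -/
theorem det_pos_of_mul_eq {a b c d : ℤ} {τ τ' : ℂ} (hτ : 0 < τ.im) (hτ' : 0 < τ'.im)
    (hne : (c : ℂ) * τ + d ≠ 0) (h : τ' * ((c : ℂ) * τ + d) = a * τ + b) :
    0 < a * d - b * c := by
  have hre := congrArg Complex.re h
  have him := congrArg Complex.im h
  have hpos := Complex.normSq_pos.2 hne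
  simp only [Complex.normSq_apply, Complex.add_re, Complex.add_im, Complex.mul_re, Complex.mul_im,
    Complex.intCast_re, Complex.intCast_im, zero_mul, sub_zero, add_zero] at hre him hpos
  have key : ((a : ℝ) * d - b * c) * τ.im =
      τ'.im * ((c * τ.re + d) * (c * τ.re + d) + c * τ.im * (c * τ.im)) := by
    linear_combination (c * τ.im) * hre - (c * τ.re + d) * him
  have : (0 : ℝ) < (a : ℝ) * d - b * c :=
    pos_of_mul_pos_left (key ▸ mul_pos hτ' hpos) hτ.le
  exact_mod_cast this

/-- Injectivity of `τ ↦ (2πi(ℤτ+ℤ), 2πi/N)`: two points `τ, τ′` of the upper half-plane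
are `Γ₁(N)`-equivalent iff there is `μ ≠ 0` with `μ·L(τ) = L(τ′)` and
`μ·(2πi/N) ≡ 2πi/N (mod L(τ′))`. -/
theorem gamma1_equiv_iff_lattice_equiv (N : ℕ) (hN : 2 ≤ N) (τ τ' : ℂ)
    (hτ : 0 < τ.im) (hτ' : 0 < τ'.im) :
    (∃ a b c d : ℤ, a * d - b * c = 1 ∧ (N : ℤ) ∣ c ∧ (N : ℤ) ∣ (a - 1) ∧
        (N : ℤ) ∣ (d - 1) ∧ ((a : ℂ) * τ + b) / ((c : ℂ) * τ + d) = τ') ↔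
    (∃ μ : ℂ, μ ≠ 0 ∧ (fun z : ℂ => μ * z) '' (latSub τ : Set ℂ) = (latSub τ' : Set ℂ) ∧
        μ * (2 * Real.pi * Complex.I / N) - 2 * Real.pi * Complex.I / N ∈ latSub τ') := by
  have hN0 : (N : ℂ) ≠ 0 := by exact_mod_cast (by omega : N ≠ 0)
  have hω : 2 * (Real.pi : ℂ) * Complex.I ≠ 0 := Complex.two_pi_I_ne_zero
  constructor
  · rintro ⟨a, b, c, d, hdet, ⟨k, rfl⟩, ⟨l, hl⟩, -, hγ⟩
    have hne := moebius_denom_ne_zero hdet hτ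
    rw [div_eq_iff hne] at hγ
    have hdetC : (a : ℂ) * d - b * ((N * k : ℤ) : ℂ) = 1 := by exact_mod_cast hdet
    have hlC : (a : ℂ) - 1 = N * l := by exact_mod_cast hl
    generalize hc : (N : ℤ) * k = c at *
    have hcC : (c : ℂ) = N * k := by rw [← hc]; push_cast; rfl
    have hinv : (a - c * τ') * ((c : ℂ) * τ + d) = 1 := by
      linear_combination hdetC + c * hγ
    have hinvτ : (a - c * τ') * τ = d * τ' - b := by
      refine mul_right_cancel₀ hne ?_
      linear_combination τ * hinv + d * hγ - τ * hdetC
    refine ⟨a - c * τ', left_ne_zero_of_mul_eq_one hinv, ?_, ?_⟩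
    · ext z
      simp only [Set.mem_image, SetLike.mem_coe, mem_latSub]
      constructor
      · rintro ⟨_, ⟨m, n, rfl⟩, rfl⟩
        refine ⟨m * d - n * c, n * a - m * b, ?_⟩
        push_cast
        linear_combination -(2 * Real.pi * Complex.I * m) * hinvτ
      · rintro ⟨m, n, rfl⟩
        refine ⟨_, ⟨m * a + n * c, m * b + n * d, rfl⟩, ?_⟩
        push_cast
        linear_combination 2 * Real.pi * Complex.I *
          ((m * τ' + n) * hinv + (a - c * τ') * m * hγ)
    · refine mem_latSub.2 ⟨-k, l, ?_⟩
      field_simp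
      push_cast
      linear_combination τ' * hcC - hlC
  · rintro ⟨μ, hμ, himg, hdiv⟩
    have himage : ∀ m n : ℤ, ∃ m' n' : ℤ, (m' : ℂ) * τ' + n' = μ * (m * τ + n) := by
      intro m n
      have hmem : μ * (2 * Real.pi * Complex.I * (m * τ + n)) ∈ (latSub τ' : Set ℂ) :=
        himg ▸ Set.mem_image_of_mem _ (mem_latSub.2 ⟨m, n, rfl⟩)
      obtain ⟨m', n', h⟩ := mem_latSub.1 hmem
      exact ⟨m', n', mul_left_cancel₀ hω (by linear_combination h)⟩
    have hpreimage : ∀ m n : ℤ, ∃ m' n' : ℤ, μ * (m' * τ + n') = (m : ℂ) * τ' + n := by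
      intro m n
      have hmem : 2 * Real.pi * Complex.I * (m * τ' + n) ∈ (latSub τ' : Set ℂ) :=
        mem_latSub.2 ⟨m, n, rfl⟩
      rw [← himg] at hmem
      obtain ⟨_, hz, h⟩ := hmem
      obtain ⟨m', n', rfl⟩ := mem_latSub.1 hz
      exact ⟨m', n', mul_left_cancel₀ hω (by linear_combination h)⟩
    obtain ⟨p, q, hpq⟩ := himage 1 0
    obtain ⟨a, b, hab⟩ := hpreimage 1 0
    obtain ⟨c, d, hcd⟩ := hpreimage 0 1
    obtain ⟨k, l, hkl⟩ := mem_latSub.1 hdiv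
    push_cast at hpq hab hcd
    have hμ' : μ = ((N * k : ℤ) : ℂ) * τ' + ((N * l + 1 : ℤ) : ℂ) := by
      refine mul_left_cancel₀ hω ?_
      field_simp at hkl
      push_cast
      linear_combination (2 * Real.pi * Complex.I) * (-hkl)
    generalize hr : (N : ℤ) * k = r at *
    generalize hs : (N : ℤ) * l + 1 = s at *
    obtain ⟨h₁, h₂⟩ := int_coords_unique hτ' (m := a * p + b * r) (n := a * q + b * s)
      (m' := 1) (n' := 0) (by push_cast; linear_combination a * hpq - b * hμ' + hab)
    obtain ⟨h₃, h₄⟩ := int_coords_unique hτ' (m := c * p + d * r) (n := c * q + d * s)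
      (m' := 0) (n' := 1) (by push_cast; linear_combination c * hpq - d * hμ' + hcd)
    have hne : (c : ℂ) * τ + d ≠ 0 := right_ne_zero_of_mul (a := μ) (by rw [hcd]; simp)
    have hγ : τ' * ((c : ℂ) * τ + d) = a * τ + b := by
      refine mul_left_cancel₀ hμ ?_
      linear_combination τ' * hcd - hab
    have hdet : a * d - b * c = 1 := by
      refine Int.eq_one_of_mul_eq_one_right (b := p * s - q * r)
        (det_pos_of_mul_eq hτ hτ' hne hγ).le ?_
      linear_combination (c * q + d * s) * h₁ + h₄ - (c * p + d * r) * h₂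
    have hc : c = -r := by linear_combination -c * h₁ + a * h₃ - r * hdet
    have ha : a = s := by linear_combination -a * h₄ + c * h₂ + s * hdet
    have hNc : (N : ℤ) ∣ c := ⟨-k, by rw [hc, ← hr]; ring⟩
    have hNa : (N : ℤ) ∣ a - 1 := ⟨l, by rw [ha, ← hs]; ring⟩
    refine ⟨a, b, c, d, hdet, hNc, hNa, ?_, ?_⟩
    · rw [show d - 1 = b * c - (a - 1) * d by linear_combination hdet]
      exact dvd_sub (hNc.mul_left b) (hNa.mul_right d)
    · rw [div_eq_iff hne, hγ]
end
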